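/- arXiv:2507.10061 — 4 statements merged into one kernel-verified Lean document; each statement's English description precedes it below -/
import Mathlib

section
/- For all natural numbers a and c with 0 ≤ c < a, one has the integer identity ∑_{b=0}^{a−c} (−1)^b · C(a−b, c) · C(a, b+1) = C(a+1, c), where C(n,k) denotes the binomial coefficient. Moreover, for c = a the same sum (which then has only the term b = 0) equals a, so the formula fails at c = a, being off by exactly 1 from C(a+1, a) = a+1. -/
open Finset in
/-- The `n`-th finite difference of `x ↦ x.choose c` vanishes for `c < n`. -/
theorem sum_neg_one_pow_mul_choose_mul_choose_sub_add {n c : ℕ} (h : c < n) (m : ℕ) :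
    ∑ k ∈ range (n + 1), (-1 : ℤ) ^ k * ((n - k + m).choose c : ℤ) * (n.choose k : ℤ) = 0 := by
  have hdiff : (fwdDiff 1)^[n] (fun x ↦ x.choose c : ℕ → ℤ) m = 0 := by
    obtain ⟨j, rfl⟩ := Nat.exists_eq_add_of_lt h
    have hc : (fwdDiff 1)^[c] (fun x ↦ x.choose c : ℕ → ℤ) = fun _ ↦ 1 := by
      simpa using fwdDiff_iter_choose 0 c
    rw [show c + j + 1 = j + 1 + c by ring, Function.iterate_add_apply, hc,
      Function.iterate_succ_apply, fwdDiff_const]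
    simp [fwdDiff_iter_eq_sum_shift]
  rw [fwdDiff_iter_eq_sum_shift] at hdiff
  rw [← sum_range_reflect, ← hdiff]
  refine sum_congr rfl fun k hk ↦ ?_
  have hk' : k ≤ n := Nat.lt_succ_iff.mp (mem_range.mp hk)
  rw [Nat.add_sub_cancel, Nat.sub_sub_self hk', Nat.choose_symm hk', smul_eq_mul, smul_eq_mul,
    mul_one, add_comm k m]
  ring


/-- Alternating-sign Chu–Vandermonde-type identity (Lemma 4.30):
for `0 ≤ c < a`, `∑_{b=0}^{a-c} (-1)^b C(a-b,c) C(a,b+1) = C(a+1,c)`;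
moreover for `c = a` the same sum (with only the `b = 0` term) equals `a`. -/
theorem alternating_binomial_identity (a c : ℕ) (h : c < a) :
    (∑ b ∈ Finset.range (a - c + 1),
      (-1 : ℤ) ^ b * ((a - b).choose c : ℤ) * (a.choose (b + 1) : ℤ))
      = ((a + 1).choose c : ℤ) ∧
    (∑ b ∈ Finset.range (a - a + 1),
      (-1 : ℤ) ^ b * ((a - b).choose a : ℤ) * (a.choose (b + 1) : ℤ))
      = (a : ℤ) := by
  refine ⟨?_, by simp⟩
  have hext : ∑ b ∈ Finset.range (a - c + 1),
      (-1 : ℤ) ^ b * ((a - b).choose c : ℤ) * (a.choose (b + 1) : ℤ) =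
      ∑ b ∈ Finset.range a, (-1 : ℤ) ^ b * ((a - b).choose c : ℤ) * (a.choose (b + 1) : ℤ) := by
    rcases Nat.eq_zero_or_pos c with rfl | hc
    · simp [Finset.sum_range_succ]
    · refine Finset.sum_subset (Finset.range_mono (by omega)) fun b hb hb' ↦ ?_
      rw [Finset.mem_range] at hb hb'
      rw [Nat.choose_eq_zero_of_lt (by omega : a - b < c)]
      simp
  have hsum := sum_neg_one_pow_mul_choose_mul_choose_sub_add h 1
  rw [Finset.sum_range_succ'] at hsum
  have hshift : ∑ k ∈ Finset.range a,
      (-1 : ℤ) ^ (k + 1) * ((a - (k + 1) + 1).choose c : ℤ) * (a.choose (k + 1) : ℤ) =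
      -∑ b ∈ Finset.range a, (-1 : ℤ) ^ b * ((a - b).choose c : ℤ) * (a.choose (b + 1) : ℤ) := by
    rw [← Finset.sum_neg_distrib]
    refine Finset.sum_congr rfl fun k hk ↦ ?_
    rw [Finset.mem_range] at hk
    rw [show a - (k + 1) + 1 = a - k by omega]
    ring
  rw [hext]
  simp only [hshift, pow_zero, Nat.sub_zero, Nat.choose_zero_right, Nat.cast_one] at hsum
  linarith
end

section
/- Let x and y be real numbers. Define the two-colored quantum numbers p, q : ℕ → ℝ by p(0) = q(0) = 0, p(1) = q(1) = 1, and for k ≥ 2, p(k) = x·q(k−1) − p(k−2) and q(k) = y·p(k−1) − q(k−2). Fix n ≥ 2 and assume p(m) ≠ 0 and q(m) ≠ 0 for all 1 ≤ m ≤ n−1. Suppose L, M : ℕ → ℝ satisfy L(2) = −x, M(2) = −y, and for all 3 ≤ k ≤ n: L(k) = −x − M(k−1)⁻¹ and M(k) = −y − L(k−1)⁻¹. Then for all 2 ≤ k ≤ n one has L(k) = −p(k)/q(k−1) and M(k) = −q(k)/p(k−1). In particular, L(n) is minus a ratio of successive two-colored quantum numbers. -/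
/-- Local intersection forms are signed ratios of successive two-colored quantum
numbers: with `p`, `q` the two-colored quantum numbers associated to `x`, `y`,
the continued-fraction recursion `L(k) = -x - M(k-1)⁻¹`, `M(k) = -y - L(k-1)⁻¹`
with base `L(2) = -x`, `M(2) = -y` has solution `L(k) = -p(k)/q(k-1)`,
`M(k) = -q(k)/p(k-1)` for `2 ≤ k ≤ n` (Theorem 4.32). -/
theorem LIF_closed_formula (x y : ℝ) (p q L M : ℕ → ℝ)
    (hp0 : p 0 = 0) (hq0 : q 0 = 0) (hp1 : p 1 = 1) (hq1 : q 1 = 1)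
    (hp : ∀ k : ℕ, 2 ≤ k → p k = x * q (k - 1) - p (k - 2))
    (hq : ∀ k : ℕ, 2 ≤ k → q k = y * p (k - 1) - q (k - 2))
    (n : ℕ) (hn : 2 ≤ n)
    (hnz : ∀ m : ℕ, 1 ≤ m → m ≤ n - 1 → p m ≠ 0 ∧ q m ≠ 0)
    (hL2 : L 2 = -x) (hM2 : M 2 = -y)
    (hLM : ∀ k : ℕ, 3 ≤ k → k ≤ n →
      L k = -x - (M (k - 1))⁻¹ ∧ M k = -y - (L (k - 1))⁻¹) :
    ∀ k : ℕ, 2 ≤ k → k ≤ n →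
      L k = -(p k / q (k - 1)) ∧ M k = -(q k / p (k - 1)) := by
  intro k hk
  induction k, hk using Nat.le_induction with
  | base =>
    intro _
    simp [hp 2 le_rfl, hq 2 le_rfl, hp0, hq0, hp1, hq1, hL2, hM2]
  | succ k hk ih =>
    intro hkn
    obtain ⟨hLk, hMk⟩ := ih (by omega)
    obtain ⟨hL, hM⟩ := hLM (k + 1) (by omega) hkn
    obtain ⟨hpk, hqk⟩ := hnz k (by omega) (by omega)
    have hpred : k + 1 - 2 = k - 1 := by omega
    rw [hL, hM, hp (k + 1) (by omega), hq (k + 1) (by omega), hpred,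
      Nat.add_sub_cancel, hLk, hMk, inv_neg, inv_neg, inv_div, inv_div]
    constructor <;> field_simp <;> ring
end

section
/- Setup: K is a field, A is a unital associative K-algebra, I ⊆ A is a two-sided ideal, and κ : A → K is a K-linear map satisfying κ(1) = 1, κ(x) = 0 for every x ∈ I, and a − κ(a)·1 ∈ I for every a ∈ A. Suppose e ∈ A satisfies κ(e) = 1 and x·e = 0 for all x ∈ I, and suppose e* ∈ A satisfies κ(e*) = 1 and e*·x = 0 for all x ∈ I. Then: (i) every g ∈ A with g·x = 0 for all x ∈ I equals κ(g)·e, and every h ∈ A with x·h = 0 for all x ∈ I equals κ(h)·e; (ii) e = e*; (iii) e·e = e; and (iv) e·x = 0 and x·e = 0 for all x ∈ I. In particular such an element e, if it exists, is unique. -/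
/-- If `g` kills `I` on its right and `h` is killed by `I` on its left, then computing `g * h` in
two ways shows that `g` and `h` are proportional. -/
theorem smul_eq_smul_of_annihilates {K A : Type*} [CommRing K] [Ring A] [Algebra K A]
    {I : TwoSidedIdeal A} {κ : A → K} (hsplit : ∀ a : A, a - κ a • (1 : A) ∈ I) {g h : A}
    (hg : ∀ x ∈ I, g * x = 0) (hh : ∀ x ∈ I, x * h = 0) : κ h • g = κ g • h := by
  have hright : g * h = κ h • g := by
    simpa [mul_sub, sub_eq_zero] using hg _ (hsplit h)
  have hleft : g * h = κ g • h := by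
    simpa [sub_mul, sub_eq_zero] using hh _ (hsplit g)
  exact hright.symm.trans hleft

/-- Uniqueness and properties of clasp idempotents (algebraic core, Section 3.4):
in a unital `K`-algebra `A` with a two-sided ideal `I` and an "identity
coefficient" functional `κ` (so `A = K·1 ⊕ I`), an element `e` with `κ(e) = 1`
annihilated by `I` on the left, together with an element `e*` with `κ(e*) = 1`
annihilating `I` on the right, satisfy: every `g` with `g·I = 0` equals `κ(g)·e`,
every `h` with `I·h = 0` equals `κ(h)·e`, `e = e*`, `e` is idempotent, `e`
annihilates `I` on both sides, and such `e` is unique. -/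
theorem clasp_idempotent_unique (K : Type*) [Field K]
    (A : Type*) [Ring A] [Algebra K A] (I : TwoSidedIdeal A)
    (κ : A →ₗ[K] K)
    (hκ1 : κ 1 = 1)
    (hκI : ∀ x ∈ I, κ x = 0)
    (hsplit : ∀ a : A, a - κ a • (1 : A) ∈ I)
    (e : A) (hκe : κ e = 1) (he : ∀ x ∈ I, x * e = 0)
    (estar : A) (hκestar : κ estar = 1) (hestar : ∀ x ∈ I, estar * x = 0) :
    (∀ g : A, (∀ x ∈ I, g * x = 0) → g = κ g • e) ∧
    (∀ h : A, (∀ x ∈ I, x * h = 0) → h = κ h • e) ∧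
    e = estar ∧
    e * e = e ∧
    (∀ x ∈ I, e * x = 0 ∧ x * e = 0) ∧
    (∀ e₂ : A, κ e₂ = 1 → (∀ x ∈ I, x * e₂ = 0) → e₂ = e) := by
  have left_eq : ∀ g : A, (∀ x ∈ I, g * x = 0) → g = κ g • e := fun g hg => by
    simpa [hκe] using smul_eq_smul_of_annihilates hsplit hg he
  have e_eq : e = estar := by simpa [hκestar] using (left_eq estar hestar).symm
  have he' : ∀ x ∈ I, e * x = 0 := e_eq ▸ hestar
  have right_eq : ∀ h : A, (∀ x ∈ I, x * h = 0) → h = κ h • e := fun h hh => by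
    simpa [hκe] using (smul_eq_smul_of_annihilates hsplit he' hh).symm
  have idem : e * e = e := by
    simpa [mul_sub, sub_eq_zero, hκe] using he' _ (hsplit e)
  exact ⟨left_eq, right_eq, e_eq, idem, fun x hx => ⟨he' x hx, he x hx⟩,
    fun e₂ hκe₂ he₂ => by simpa [hκe₂] using right_eq e₂ he₂⟩
end

section
/- Setup: K is a field, A is a unital associative K-algebra, I ⊆ A is a two-sided ideal, and κ : A → K is a K-linear map satisfying κ(1) = 1, κ(x) = 0 for every x ∈ I, and a − κ(a)·1 ∈ I for every a ∈ A. Let e ∈ A satisfy κ(e) = 1 and e·x = 0 = x·e for all x ∈ I. Let e′ ∈ A be an idempotent (e′·e′ = e′) such that 1 − e′ ∈ I and such that the only idempotent elements of the corner ring e′·A·e′ are 0 and e′. Then e = e′. -/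
/-- All top idempotents equal the clasp idempotent (algebraic core of
Theorem 3.12): if `e` has identity coefficient `1` and annihilates the ideal
`I` of lower terms on both sides, and `e'` is an idempotent with `1 - e' ∈ I`
whose corner ring `e'·A·e'` contains no idempotents besides `0` and `e'`,
then `e = e'`. -/
theorem top_idempotent_eq_clasp (K : Type*) [Field K]
    (A : Type*) [Ring A] [Algebra K A] (I : TwoSidedIdeal A)
    (κ : A →ₗ[K] K)
    (hκ1 : κ 1 = 1)
    (hκI : ∀ x ∈ I, κ x = 0)
    (hsplit : ∀ a : A, a - κ a • (1 : A) ∈ I)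
    (e : A) (hκe : κ e = 1)
    (heI : ∀ x ∈ I, e * x = 0 ∧ x * e = 0)
    (e' : A) (he' : e' * e' = e')
    (hlow : (1 : A) - e' ∈ I)
    (hcorner : ∀ z : A, z = e' * z * e' → z * z = z → z = 0 ∨ z = e') :
    e = e' := by
  have he_right : e * e' = e := by
    have h := (heI _ hlow).1
    rw [mul_sub, mul_one, sub_eq_zero] at h
    exact h.symm
  have he_left : e' * e = e := by
    have h := (heI _ hlow).2
    rw [sub_mul, one_mul, sub_eq_zero] at h
    exact h.symm
  have he_idem : e * e = e := by
    have hmem := hsplit e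
    rw [hκe, one_smul] at hmem
    have h := (heI _ hmem).1
    rwa [mul_sub, mul_one, sub_eq_zero] at h
  refine (hcorner e (by rw [he_left, he_right]) he_idem).resolve_left ?_
  rintro rfl
  simp at hκe
end
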